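/- Let u, v be words, let I ⊆ {1,...,|u|} and J ⊆ {|u|+1,...,|u|+|v|}, and let J' = {i − |u| : i ∈ J}. Then pack((u*v)[I ∪ J]) = pack(u[I]) * pack(v[J']). -/

import Mathlib

/-- Words over the alphabet `X = {x_i : i ≥ 0}`, identified with lists of natural numbers. -/
abbrev Word : Type := List ℕ

/-- `IAlph w` is the set of indices of letters occurring in `w`. -/
def IAlph (w : Word) : Finset ℕ := w.toFinset

/-- `wsup w` is the supremum of `IAlph w` (0 for the empty word). -/
def wsup (w : Word) : ℕ := w.foldr max 0

/-- The substitution `S_φ` replaces each letter `x_i` by `x_{φ i}`. -/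
def subst (φ : ℕ → ℕ) (w : Word) : Word := w.map φ

/-- The packing substitution `φ_w`: it sends the `m`-th smallest nonzero letter of `w` to `m`,
and `0` to `0`. -/
def packMap (w : Word) (i : ℕ) : ℕ := (((IAlph w).erase 0).filter (fun j => j ≤ i)).card

/-- `pack w = S_{φ_w} w`. -/
def pack (w : Word) : Word := subst (packMap w) w

/-- A word is packed if `pack w = w`. -/
def IsPacked (w : Word) : Prop := pack w = w

/-- `T_t`: shift every nonzero letter by `t`, fixing `x_0`. -/
def shiftW (t : ℕ) (w : Word) : Word := subst (fun n => if n = 0 then 0 else n + t) w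

/-- Shifted concatenation `u * v = u · T_{sup u}(v)`. -/
def sc (u v : Word) : Word := u ++ shiftW (wsup u) v

/-- `w[I]`: the subword of `w` formed by the letters at the (1-indexed) positions in `I`,
taken in increasing order of position. -/
def subword (w : Word) (I : Finset ℕ) : Word :=
  ((List.range w.length).filter (fun j => decide (j + 1 ∈ I))).map (fun j => w.getD j 0)

/-- Quotient by a set of indices: `w / A = S_{φ_A} w` where `φ_A i = 0` if `i ∈ A`, else `i`. -/
def quotSet (w : Word) (A : Finset ℕ) : Word := subst (fun i => if i ∈ A then 0 else i) w

/-- Quotient by a word: `w / u = w / IAlph u`. -/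
def quotWord (w u : Word) : Word := quotSet w (IAlph u)

theorem le_wsup {w : Word} {a : ℕ} (h : a ∈ w) : a ≤ wsup w := by
  induction w with
  | nil => simp at h
  | cons b w ih =>
    simp only [wsup, List.foldr_cons, List.mem_cons] at h ih ⊢
    rcases h with rfl | h
    · exact le_max_left _ _
    · exact (ih h).trans (le_max_right _ _)

theorem wsup_le {w : Word} {n : ℕ} (h : ∀ a ∈ w, a ≤ n) : wsup w ≤ n := by
  induction w with
  | nil => simp [wsup]
  | cons b w ih =>
    simp only [wsup, List.foldr_cons, List.mem_cons] at h ih ⊢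
    exact max_le (h b (Or.inl rfl)) (ih fun a ha => h a (Or.inr ha))

theorem packMap_zero (w : Word) : packMap w 0 = 0 := by
  simp only [packMap, Finset.card_eq_zero, Finset.filter_eq_empty_iff, Finset.mem_erase]
  omega

theorem packMap_pos {w : Word} {a : ℕ} (ha : a ∈ w) (h0 : a ≠ 0) : 0 < packMap w a :=
  Finset.card_pos.2 ⟨a, by simp [IAlph, ha, h0]⟩

theorem wsup_pack (w : Word) : wsup (pack w) = ((IAlph w).erase 0).card := by
  apply le_antisymm
  · refine wsup_le fun a ha => ?_
    obtain ⟨b, -, rfl⟩ := List.mem_map.1 ha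
    exact Finset.card_filter_le _ _
  · rcases ((IAlph w).erase 0).eq_empty_or_nonempty with h | h
    · simp [h]
    · have hm := Finset.max'_mem _ h
      have hw : ((IAlph w).erase 0).max' h ∈ w := by
        simpa [IAlph] using Finset.mem_of_mem_erase hm
      have hp : packMap w (((IAlph w).erase 0).max' h) = ((IAlph w).erase 0).card := by
        rw [packMap, Finset.filter_true_of_mem fun j hj => Finset.le_max' _ j hj]
      rw [← hp]
      exact le_wsup (List.mem_map_of_mem hw)

theorem erase_IAlph_append_shiftW (u v : Word) (t : ℕ) :
    (IAlph (u ++ shiftW t v)).erase 0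
      = (IAlph u).erase 0 ∪ ((IAlph v).erase 0).image (fun n => n + t) := by
  ext a
  simp only [IAlph, shiftW, subst, Finset.mem_erase, List.mem_toFinset, List.mem_append,
    List.mem_map, Finset.mem_union, Finset.mem_image]
  constructor
  · rintro ⟨h0, h | ⟨b, hb, rfl⟩⟩
    · exact Or.inl ⟨h0, h⟩
    · have hb0 : b ≠ 0 := by rintro rfl; simp at h0
      exact Or.inr ⟨b, ⟨hb0, hb⟩, by simp [hb0]⟩
  · rintro (⟨h0, h⟩ | ⟨b, ⟨hb0, hb⟩, rfl⟩)
    · exact ⟨h0, Or.inl h⟩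
    · exact ⟨by omega, Or.inr ⟨b, hb, by simp [hb0]⟩⟩

theorem packMap_append_shiftW_of_le (u v : Word) {t a : ℕ} (ha : a ≤ t) :
    packMap (u ++ shiftW t v) a = packMap u a := by
  have h : (((IAlph v).erase 0).image (fun n => n + t)).filter (fun j => j ≤ a) = ∅ := by
    simp only [Finset.filter_eq_empty_iff, Finset.mem_image, Finset.mem_erase]
    rintro _ ⟨b, ⟨hb, -⟩, rfl⟩
    omega
  rw [packMap, erase_IAlph_append_shiftW, Finset.filter_union, h, Finset.union_empty, packMap]

theorem packMap_append_shiftW_add {u : Word} (v : Word) {t : ℕ} (hu : ∀ a ∈ u, a ≤ t) (b : ℕ) :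
    packMap (u ++ shiftW t v) (b + t) = packMap v b + wsup (pack u) := by
  have hle : ∀ j ∈ (IAlph u).erase 0, j ≤ t := fun j hj =>
    hu j (by simpa [IAlph] using Finset.mem_of_mem_erase hj)
  rw [packMap, erase_IAlph_append_shiftW, Finset.filter_union,
    Finset.filter_true_of_mem fun j hj => (hle j hj).trans (Nat.le_add_left t b),
    Finset.card_union_of_disjoint, Finset.filter_image,
    Finset.card_image_of_injective _ (add_left_injective t), wsup_pack, packMap, add_comm]
  · simp only [add_le_add_iff_right]
  · rw [Finset.disjoint_left]
    intro j hj hj'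
    simp only [Finset.mem_filter, Finset.mem_image, Finset.mem_erase] at hj'
    obtain ⟨⟨c, ⟨hc, -⟩, rfl⟩, -⟩ := hj'
    have := hle _ hj
    omega

theorem pack_append_shiftW {u : Word} (v : Word) {t : ℕ} (hu : ∀ a ∈ u, a ≤ t) :
    pack (u ++ shiftW t v) = sc (pack u) (pack v) := by
  have h₁ : subst (packMap (u ++ shiftW t v)) u = pack u :=
    List.map_congr_left fun a ha => packMap_append_shiftW_of_le u v (hu a ha)
  have h₂ : subst (packMap (u ++ shiftW t v)) (shiftW t v) = shiftW (wsup (pack u)) (pack v) := by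
    simp only [subst, shiftW, pack, List.map_map]
    refine List.map_congr_left fun b hb => ?_
    by_cases h0 : b = 0
    · simp [h0, packMap_zero]
    · have hp := (packMap_pos hb h0).ne'
      simpa [h0, hp, pack, subst, shiftW] using packMap_append_shiftW_add v hu b
  rw [sc, ← h₂, ← h₁]
  exact List.map_append

theorem mem_of_mem_subword {w : Word} {I : Finset ℕ} {a : ℕ} (h : a ∈ subword w I) : a ∈ w := by
  simp only [subword, List.mem_map, List.mem_filter, List.mem_range] at h
  obtain ⟨j, ⟨hj, -⟩, rfl⟩ := h
  rw [List.getD_eq_getElem _ _ hj]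
  exact List.getElem_mem hj

theorem subword_subst {φ : ℕ → ℕ} (hφ : φ 0 = 0) (w : Word) (I : Finset ℕ) :
    subword (subst φ w) I = subst φ (subword w I) := by
  simp only [subword, subst, List.length_map, List.map_map]
  refine List.map_congr_left fun j _ => ?_
  rw [Function.comp_apply, ← List.getD_map (f := φ), hφ]

theorem subword_append {u v : Word} {I J : Finset ℕ} (hI : I ⊆ Finset.Icc 1 u.length)
    (hJ : J ⊆ Finset.Icc (u.length + 1) (u.length + v.length)) :
    subword (u ++ v) (I ∪ J)
      = subword u I ++ subword v (J.image fun i => i - u.length) := by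
  simp only [subword, List.length_append, List.range_add, List.filter_append, List.map_append,
    List.filter_map, List.map_map]
  congr 1
  · have hf : (List.range u.length).filter (fun j => decide (j + 1 ∈ I ∪ J))
        = (List.range u.length).filter (fun j => decide (j + 1 ∈ I)) := by
      refine List.filter_congr fun j hj => ?_
      have hjJ : j + 1 ∉ J := fun h => by
        have h₁ := Finset.mem_Icc.1 (hJ h)
        have h₂ := List.mem_range.1 hj
        omega
      simp [hjJ]
    rw [hf]
    refine List.map_congr_left fun j hj => ?_
    exact List.getD_append _ _ _ _ (List.mem_range.1 (List.mem_filter.1 hj).1)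
  · have hf : (List.range v.length).filter
          ((fun j => decide (j + 1 ∈ I ∪ J)) ∘ fun j => u.length + j)
        = (List.range v.length).filter
          (fun j => decide (j + 1 ∈ J.image fun i => i - u.length)) := by
      refine List.filter_congr fun j _ => ?_
      simp only [Function.comp_apply, decide_eq_decide, Finset.mem_union, Finset.mem_image]
      constructor
      · rintro (h | h)
        · have := Finset.mem_Icc.1 (hI h)
          omega
        · exact ⟨_, h, by omega⟩
      · rintro ⟨i, hi, hij⟩
        have hij' : u.length + j + 1 = i := by omega
        exact Or.inr (hij' ▸ hi)
    rw [hf]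
    refine List.map_congr_left fun j _ => ?_
    rw [Function.comp_apply, List.getD_append_right _ _ _ _ (Nat.le_add_right _ _),
      Nat.add_sub_cancel_left]

/-- Let `u, v` be words, `I ⊆ {1,…,|u|}`, `J ⊆ {|u|+1,…,|u|+|v|}` and
`J' = {i - |u| : i ∈ J}`. Then `pack((u*v)[I ∪ J]) = pack(u[I]) * pack(v[J'])`. -/
theorem pack_subword_sc (u v : Word) (I J : Finset ℕ)
    (hI : I ⊆ Finset.Icc 1 u.length)
    (hJ : J ⊆ Finset.Icc (u.length + 1) (u.length + v.length)) :
    pack (subword (sc u v) (I ∪ J))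
      = sc (pack (subword u I)) (pack (subword v (J.image fun i => i - u.length))) := by
  have hJ' : J ⊆ Finset.Icc (u.length + 1) (u.length + (shiftW (wsup u) v).length) := by
    simpa [shiftW, subst] using hJ
  rw [sc, subword_append hI hJ', shiftW, subword_subst (by simp)]
  exact pack_append_shiftW _ fun a ha => le_wsup (mem_of_mem_subword ha)
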